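/- There is an absolute constant C > 0 with the following property. Let X ≥ 1 and 3 ≤ Y ≤ X, and let c : ℕ → ℂ be supported on (X, 2X]. Let α ∈ ℝ, let a ∈ ℤ and q ≥ 1 be an integer with gcd(a, q) = 1, and suppose |α − a/q| ≤ 1/(2Y). Then ∫_{α−1/Y}^{α+1/Y} |Σ_{X<n≤2X} c(n) e(nβ)|² dβ ≤ (C/Y²) · ∫_{−∞}^{∞} |Σ_{u<n≤u+Y/3} c(n) e(na/q)|² du. -/

import Mathlib

open MeasureTheory

/-- `e(x) = e^{2πix}`. -/
noncomputable def e (x : ℝ) : ℂ := Complex.exp (2 * Real.pi * Complex.I * (x : ℂ))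

section Plancherel

open FourierTransform SchwartzMap
open scoped ContDiff

variable {V F : Type*} [NormedAddCommGroup V] [InnerProductSpace ℝ V] [FiniteDimensional ℝ V]
  [MeasurableSpace V] [BorelSpace V]
  [NormedAddCommGroup F] [InnerProductSpace ℂ F] [CompleteSpace F]

/-- On `L¹ ∩ L²` the Fourier transform of `L²` agrees with the Fourier integral. -/
theorem MeasureTheory.MemLp.coeFn_fourier_toLp {f : V → F} (hf : MemLp f 2) (hf1 : Integrable f) :
    (𝓕 (hf.toLp f) : Lp F 2 (volume : Measure V)) =ᵐ[volume] 𝓕 f := by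
  have hcont : Continuous (𝓕 f) := VectorFourier.fourierIntegral_continuous
    Real.continuous_fourierChar (innerSL ℝ).continuous₂ hf1
  refine ae_eq_of_integral_contDiff_smul_eq ((Lp.memLp _).locallyIntegrable one_le_two)
    hcont.locallyIntegrable fun g g_smooth g_cpt => ?_
  have hg₁ : HasCompactSupport (Complex.ofRealCLM ∘ g) := g_cpt.comp_left rfl
  have hg₂ : ContDiff ℝ ∞ (Complex.ofRealCLM ∘ g) := by fun_prop
  set φ : 𝓢(V, ℂ) := hg₁.toSchwartzMap hg₂
  calc ∫ x, g x • (𝓕 (hf.toLp f) : Lp F 2 (volume : Measure V)) x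
      = Lp.toTemperedDistribution (𝓕 (hf.toLp f) : Lp F 2 (volume : Measure V)) φ := by simp [φ]
    _ = ∫ x, (𝓕 φ) x • f x := by
      rw [← Lp.fourier_toTemperedDistribution_eq, TemperedDistribution.fourier_apply,
        Lp.toTemperedDistribution_apply]
      refine integral_congr_ae ?_
      filter_upwards [hf.coeFn_toLp] with x hx
      rw [hx]
    _ = ∫ x, φ x • 𝓕 f x := by
      rw [SchwartzMap.fourier_coe]
      have h := VectorFourier.integral_fourierIntegral_smul_eq_flip (L := innerₗ V)
        Real.continuous_fourierChar continuous_inner (φ.integrable (μ := volume)) hf1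
      rwa [flip_innerₗ] at h
    _ = ∫ x, g x • 𝓕 f x := by simp [φ]

theorem MeasureTheory.MemLp.memLp_fourier {f : V → F} (hf : MemLp f 2) (hf1 : Integrable f) :
    MemLp (𝓕 f) 2 :=
  (memLp_congr_ae (hf.coeFn_fourier_toLp hf1)).1 (Lp.memLp _)

/-- Plancherel's theorem on `L¹ ∩ L²`. -/
theorem MeasureTheory.MemLp.integral_norm_fourier_sq {f : V → F} (hf : MemLp f 2)
    (hf1 : Integrable f) : ∫ ξ, ‖𝓕 f ξ‖ ^ 2 = ∫ x, ‖f x‖ ^ 2 := by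
  have key (g : Lp F 2 (volume : Measure V)) : (inner ℂ g g : ℂ) = (∫ x, ‖g x‖ ^ 2 : ℝ) := by
    rw [L2.inner_def, ← integral_complex_ofReal]
    simp [inner_self_eq_norm_sq_to_K]
  have h := Lp.inner_fourier_eq (hf.toLp f) (hf.toLp f)
  rw [key, key, Complex.ofReal_inj] at h
  have h1 := integral_congr_ae ((hf.coeFn_fourier_toLp hf1).fun_comp fun z => ‖z‖ ^ 2)
  have h2 := integral_congr_ae (hf.coeFn_toLp.fun_comp fun z => ‖z‖ ^ 2)
  exact h1.symm.trans (h.trans h2)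

end Plancherel

theorem e_add (x y : ℝ) : e (x + y) = e x * e y := by
  simp only [e, ← Complex.exp_add]
  congr 1
  push_cast
  ring

theorem continuous_e : Continuous e := by
  unfold e
  fun_prop

theorem norm_e (x : ℝ) : ‖e x‖ = 1 := by
  rw [e, show 2 * Real.pi * Complex.I * (x : ℂ) = ((2 * Real.pi * x : ℝ) : ℂ) * Complex.I by
    push_cast; ring]
  exact Complex.norm_exp_ofReal_mul_I _

theorem norm_integral_e_mul_ge {δ t : ℝ} (hδ : 0 < δ) (ht : |t| * δ ≤ 1 / 2) :
    δ / 2 ≤ ‖∫ v in (0 : ℝ)..δ, e (v * t)‖ := by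
  rcases eq_or_ne t 0 with rfl | h0
  · simp [e, abs_of_pos hδ]
    linarith
  have hc : (2 * Real.pi * t * Complex.I : ℂ) ≠ 0 := by
    simp [h0, Real.pi_ne_zero]
  have h1 : ∫ v in (0 : ℝ)..δ, e (v * t) =
      (Complex.exp (Complex.I * (2 * Real.pi * t * δ : ℝ)) - 1) / (2 * Real.pi * t * Complex.I) := by
    have h2 : (fun v : ℝ => e (v * t)) =
        fun v : ℝ => Complex.exp ((2 * Real.pi * t * Complex.I : ℂ) * v) := by
      funext v
      rw [e]
      congr 1
      push_cast
      ring
    rw [h2, integral_exp_mul_complex hc]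
    simp only [Complex.ofReal_zero, mul_zero, Complex.exp_zero]
    congr 3
    push_cast
    ring
  have hpi := Real.pi_pos
  have ht0 : 0 < |t| := abs_pos.2 h0
  have hsin := Real.mul_abs_le_abs_sin (x := Real.pi * t * δ) (by
    rw [abs_mul, abs_mul, abs_of_pos hpi, abs_of_pos hδ]
    nlinarith)
  rw [abs_mul, abs_mul, abs_of_pos hpi, abs_of_pos hδ] at hsin
  have hsin' : 2 * (|t| * δ) ≤ |Real.sin (Real.pi * t * δ)| := by
    refine le_trans (le_of_eq ?_) hsin
    field_simp
  rw [h1, norm_div, Complex.norm_exp_I_mul_ofReal_sub_one,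
    show 2 * Real.pi * t * δ / 2 = Real.pi * t * δ by ring]
  simp only [norm_mul, Complex.norm_I, mul_one, Complex.norm_real, Real.norm_eq_abs,
    abs_of_pos hpi, Complex.norm_ofNat, abs_two]
  rw [le_div_iff₀ (by positivity)]
  nlinarith [Real.pi_le_four, mul_pos ht0 hδ]

section ShortSums

open FourierTransform

/-- The short sum `∑_{u < n ≤ u + δ} b n`, over `n` in a finite set. -/
noncomputable def shortSum (s : Finset ℕ) (b : ℕ → ℂ) (δ u : ℝ) : ℂ :=
  ∑ n ∈ s, (Set.Ico ((n : ℝ) - δ) n).indicator (fun _ => b n) u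

theorem memLp_shortSum (s : Finset ℕ) (b : ℕ → ℂ) (δ : ℝ) (p : ENNReal) :
    MemLp (shortSum s b δ) p := by
  unfold shortSum
  exact memLp_finsetSum s fun n _ =>
    memLp_indicator_const p measurableSet_Ico (b n) (Or.inr (by simp))

theorem fourier_shortSum (s : Finset ℕ) (b : ℕ → ℂ) {δ : ℝ} (hδ : 0 < δ) (t : ℝ) :
    𝓕 (shortSum s b δ) (-t) =
      (∑ n ∈ s, b n * e (n * t)) * ∫ v in (0 : ℝ)..δ, e (v * -t) := by
  have hker (v : ℝ) : Complex.exp (↑(-2 * Real.pi * v * (-t)) * Complex.I) = e (v * t) := by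
    rw [e]
    congr 1
    push_cast
    ring
  simp only [Real.fourier_real_eq_integral_exp_smul, hker, smul_eq_mul]
  have hind (v : ℝ) : e (v * t) * shortSum s b δ v = ∑ n ∈ s,
      (Set.Ico ((n : ℝ) - δ) n).indicator (fun w => e (w * t) * b n) v := by
    rw [shortSum, Finset.mul_sum]
    refine Finset.sum_congr rfl fun n _ => ?_
    rw [Set.indicator_apply, Set.indicator_apply]
    split_ifs <;> simp
  simp only [hind]
  rw [integral_finsetSum, Finset.sum_mul]
  · refine Finset.sum_congr rfl fun n _ => ?_
    rw [integral_indicator measurableSet_Ico, integral_Ico_eq_integral_Ioc,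
      ← intervalIntegral.integral_of_le (by linarith), intervalIntegral.integral_mul_const,
      mul_comm, mul_assoc]
    congr 1
    rw [← intervalIntegral.integral_const_mul]
    have := intervalIntegral.integral_comp_sub_left (a := 0) (b := δ)
      (fun w : ℝ => e (w * t)) (n : ℝ)
    rw [sub_zero] at this
    rw [← this]
    congr 1
    funext v
    rw [← e_add]
    congr 1
    ring
  · intro n _
    have : Continuous fun w : ℝ => e (w * t) * b n :=
      (continuous_e.comp (by fun_prop)).mul continuous_const
    exact (integrable_indicator_iff measurableSet_Ico).2
      (this.integrableOn_Icc.mono_set Set.Ico_subset_Icc_self)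

/-- Gallagher's lemma for finite exponential sums. -/
theorem integral_norm_exp_sum_sq_le (s : Finset ℕ) (b : ℕ → ℂ) {δ : ℝ} (hδ : 0 < δ) {S : Set ℝ}
    (hS : MeasurableSet S) (hSδ : ∀ t ∈ S, |t| * δ ≤ 1 / 2) :
    ∫ t in S, ‖∑ n ∈ s, b n * e (n * t)‖ ^ 2 ≤ 4 / δ ^ 2 * ∫ u, ‖shortSum s b δ u‖ ^ 2 := by
  have h1 : Integrable (shortSum s b δ) := memLp_one_iff_integrable.1 (memLp_shortSum s b δ 1)
  have h2 := memLp_shortSum s b δ 2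
  have h_int : Integrable fun t => 4 / δ ^ 2 * ‖𝓕 (shortSum s b δ) (-t)‖ ^ 2 := by
    have h3 := (memLp_two_iff_integrable_sq_norm (h2.memLp_fourier h1).1).1 (h2.memLp_fourier h1)
    exact h3.comp_neg.const_mul _
  rw [← h2.integral_norm_fourier_sq h1,
    ← integral_neg_eq_self (fun t => ‖𝓕 (shortSum s b δ) t‖ ^ 2), ← integral_const_mul]
  refine le_trans ?_ (setIntegral_le_integral (s := S) h_int
    (Filter.Eventually.of_forall fun t => by positivity))
  refine integral_mono_of_nonneg (Filter.Eventually.of_forall fun t => by positivity)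
    h_int.integrableOn ((ae_restrict_iff' hS).2 (Filter.Eventually.of_forall fun t ht => ?_))
  dsimp only
  rw [fourier_shortSum s b hδ, norm_mul, mul_pow]
  have hk := norm_integral_e_mul_ge (t := -t) hδ (by rw [abs_neg]; exact hSδ t ht)
  have hk2 := pow_le_pow_left₀ (by positivity) hk 2
  calc ‖∑ n ∈ s, b n * e (n * t)‖ ^ 2
      = 4 / δ ^ 2 * (‖∑ n ∈ s, b n * e (n * t)‖ ^ 2 * (δ / 2) ^ 2) := by
        generalize ‖∑ n ∈ s, b n * e (n * t)‖ = x
        field_simp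
        ring
    _ ≤ _ := by gcongr

end ShortSums

/-- Lemma 2.1 (a consequence of Gallagher's lemma): there is an absolute constant
`C > 0` such that for every `X ≥ 1`, every `3 ≤ Y ≤ X`, every `c : ℕ → ℂ` supported
on `(X, 2X]`, every `α ∈ ℝ` and integers `a`, `q ≥ 1` with `gcd(a,q) = 1` and
`|α - a/q| ≤ 1/(2Y)`, one has
`∫_{α-1/Y}^{α+1/Y} |∑_{X<n≤2X} c(n) e(nβ)|² dβ
  ≤ (C/Y²) ∫_ℝ |∑_{u<n≤u+Y/3} c(n) e(na/q)|² du`. -/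
theorem stmt_2 :
    ∃ C : ℝ, 0 < C ∧
      ∀ (X Y : ℝ), 1 ≤ X → 3 ≤ Y → Y ≤ X → ∀ c : ℕ → ℂ,
        (∀ n : ℕ, c n ≠ 0 → X < (n : ℝ) ∧ (n : ℝ) ≤ 2 * X) →
        ∀ (α : ℝ) (a : ℤ) (q : ℕ), 1 ≤ q → Int.gcd a (q : ℤ) = 1 →
          |α - (a : ℝ) / (q : ℝ)| ≤ 1 / (2 * Y) →
          (∫ β in (α - 1 / Y)..(α + 1 / Y), ‖∑' n : ℕ, c n * e ((n : ℝ) * β)‖ ^ 2)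
            ≤ C / Y ^ 2 *
              ∫ u : ℝ, ‖∑' n : ℕ,
                if u < (n : ℝ) ∧ (n : ℝ) ≤ u + Y / 3
                  then c n * e ((n : ℝ) * (a : ℝ) / (q : ℝ)) else 0‖ ^ 2 := by
  refine ⟨36, by norm_num, fun X Y _ hY _ c hc α a q _ _ hα => ?_⟩
  have hY0 : 0 < Y := by linarith
  set s : Finset ℕ := Finset.range (⌊2 * X⌋₊ + 1)
  have hs (n : ℕ) (hn : n ∉ s) : c n = 0 := by
    by_contra h
    exact hn (Finset.mem_range.2 (Nat.lt_succ_of_le (Nat.le_floor (hc n h).2)))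
  set r : ℝ := (a : ℝ) / q
  set b : ℕ → ℂ := fun n => c n * e ((n : ℝ) * (a : ℝ) / (q : ℝ))
  have hlong (β : ℝ) : ∑' n : ℕ, c n * e ((n : ℝ) * β) = ∑ n ∈ s, b n * e (n * (β - r)) := by
    rw [tsum_eq_sum (s := s) fun n hn => by rw [hs n hn, zero_mul]]
    refine Finset.sum_congr rfl fun n _ => ?_
    rw [mul_assoc, ← e_add]
    congr 2
    simp only [r]
    ring
  have hshort (u : ℝ) : (∑' n : ℕ, if u < (n : ℝ) ∧ (n : ℝ) ≤ u + Y / 3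
      then c n * e ((n : ℝ) * (a : ℝ) / (q : ℝ)) else 0) = shortSum s b (Y / 3) u := by
    rw [tsum_eq_sum (s := s) fun n hn => by simp [hs n hn], shortSum]
    refine Finset.sum_congr rfl fun n _ => ?_
    rw [Set.indicator_apply]
    refine if_congr ?_ rfl rfl
    rw [Set.mem_Ico, sub_le_iff_le_add, and_comm]
  simp only [hlong, hshort]
  rw [intervalIntegral.integral_comp_sub_right
      (fun t => ‖∑ n ∈ s, b n * e (n * t)‖ ^ 2) r,
    intervalIntegral.integral_of_le (by linarith [one_div_pos.2 hY0])]
  refine (integral_norm_exp_sum_sq_le s b (δ := Y / 3) (by positivity) measurableSet_Ioc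
    fun t ht => ?_).trans_eq ?_
  · have h1 : 1 / (2 * Y) = 1 / Y / 2 := by field_simp
    rw [h1] at hα
    have hα' := abs_le.1 hα
    have h2 : |t| ≤ 3 / 2 * (1 / Y) := abs_le.2 ⟨by linarith [ht.1], by linarith [ht.2]⟩
    calc |t| * (Y / 3) ≤ 3 / 2 * (1 / Y) * (Y / 3) := by gcongr
      _ = 1 / 2 := by field_simp
  · congr 1
    field_simp
    norm_num
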